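/- Let ρ = (G_i)_{0 ≤ i ≤ n} be a 1-balanced execution of the reconfigurable broadcast network defined by a broadcast protocol P, and let G_b ⋯ G_e be a phase of ρ. Then there exists κ ≤ (e − b)/2 such that for every N ∈ ℕ there exists a 1-constrained execution from G_0^κ ⊕ G_b^N to G_1^κ ⊕ G_e^N. -/

import Mathlib

/-!
Reconfigurable broadcast networks (Maubert–Pinchinat–Schlehuber-Caissier style
formalization of "Reconfiguration and message losses in parameterized broadcast networks").

A broadcast protocol is a tuple (Q, I, Σ, Δ); configurations are finite
Q-labelled simple graphs; steps are reconfiguration steps (labels unchanged,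
edges arbitrary) or communication steps (edges unchanged, one node broadcasts,
its neighbours receive); executions strictly alternate the two kinds of steps.
-/

namespace RBN

/-- An action of a broadcast protocol: broadcast `!!m` or reception `??m`. -/
inductive BAct (M : Type) where
  | brd : M → BAct M
  | rcv : M → BAct M

/-- A broadcast protocol `(Q, I, Σ, Δ)` with state space `Q` and message alphabet `M`:
initial states `init ⊆ Q` and transition relation `trans ⊆ Q × BAct M × Q`. -/
structure BroadcastProtocol (Q M : Type) where
  init : Set Q
  trans : Q → BAct M → Q → Prop

/-- A configuration: an undirected graph without self-loops on node set `V`,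
whose nodes are labelled by states in `Q`. -/
structure Config (V Q : Type) where
  graph : SimpleGraph V
  label : V → Q

/-- The distance `d(G, G')` between two configurations on the same node set with
the same labelling: the number of edges in the symmetric difference of the edge sets. -/
noncomputable def dist {V Q : Type} (G G' : Config V Q) : ℕ :=
  (symmDiff G.graph.edgeSet G'.graph.edgeSet).ncard

/-- The number of edges incident to node `v` in the symmetric difference of
the edge sets of `G` and `G'`. -/
noncomputable def localDist {V Q : Type} (v : V) (G G' : Config V Q) : ℕ :=
  {e ∈ symmDiff G.graph.edgeSet G'.graph.edgeSet | v ∈ e}.ncard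

/-- A reconfiguration step: labels are unchanged and edges may change arbitrarily. -/
def ReconfStep {V Q : Type} (G G' : Config V Q) : Prop :=
  G'.label = G.label

/-- A communication step: edges are unchanged, some node `v` broadcasts a message `m`
(performing a transition `(L v, !!m, L' v) ∈ Δ`), every neighbour `u` of `v` receives it
(performing `(L u, ??m, L' u) ∈ Δ`), and every other node keeps its label. -/
def CommStep {V Q M : Type} (P : BroadcastProtocol Q M) (G G' : Config V Q) : Prop :=
  G'.graph = G.graph ∧
  ∃ (v : V) (m : M),
    P.trans (G.label v) (.brd m) (G'.label v) ∧
    (∀ u, G.graph.Adj v u → P.trans (G.label u) (.rcv m) (G'.label u)) ∧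
    (∀ u, u ≠ v → ¬ G.graph.Adj v u → G'.label u = G.label u)

/-- The type of a step: communication or reconfiguration. -/
inductive StepType where
  | comm : StepType
  | reconf : StepType
deriving DecidableEq

/-- An execution of length `r` of the reconfigurable broadcast network defined by `P`,
with node set `V`: a sequence of configurations `cfg 0, …, cfg r` together with a
classification `ty` of each step, such that each step is of its declared kind and
communication and reconfiguration steps strictly alternate (reconfiguration steps
may be trivial). -/
structure Execution {Q M : Type} (V : Type) (P : BroadcastProtocol Q M) (r : ℕ) where
  cfg : ℕ → Config V Q
  ty : ℕ → StepType
  step_comm : ∀ i < r, ty i = .comm → CommStep P (cfg i) (cfg (i + 1))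
  step_reconf : ∀ i < r, ty i = .reconf → ReconfStep (cfg i) (cfg (i + 1))
  alternate : ∀ i, i + 1 < r → ty (i + 1) ≠ ty i

variable {Q M V : Type} {P : BroadcastProtocol Q M} {r : ℕ}

/-- An execution is initial if every node of its first configuration is labelled
by an initial state. -/
def Execution.Initial (ρ : Execution V P r) : Prop :=
  ∀ v, (ρ.cfg 0).label v ∈ P.init

/-- An execution synchronizes in `F` if every node of its last configuration is
labelled by a state in `F`. -/
def Execution.Synchronizes (ρ : Execution V P r) (F : Set Q) : Prop :=
  ∀ v, (ρ.cfg r).label v ∈ F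

/-- An execution is `k`-constrained if every reconfiguration step changes at most
`k` edges. -/
def Execution.KConstrained (k : ℕ) (ρ : Execution V P r) : Prop :=
  ∀ i < r, ρ.ty i = .reconf → dist (ρ.cfg i) (ρ.cfg (i + 1)) ≤ k

/-- An execution is strongly `k`-constrained if every reconfiguration step changes
exactly `k` edges. -/
def Execution.StronglyKConstrained (k : ℕ) (ρ : Execution V P r) : Prop :=
  ∀ i < r, ρ.ty i = .reconf → dist (ρ.cfg i) (ρ.cfg (i + 1)) = k

/-- An execution is `k`-locally-constrained if, at every step and for every node `v`,
at most `k` edges incident to `v` belong to the symmetric difference of the edge sets. -/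
def Execution.LocallyConstrained (k : ℕ) (ρ : Execution V P r) : Prop :=
  ∀ (v : V), ∀ i < r, localDist v (ρ.cfg i) (ρ.cfg (i + 1)) ≤ k

/-- An execution is `f`-constrained if every reconfiguration step changes at most
`f n` edges, where `n` is the number of nodes. -/
def Execution.FConstrained [Fintype V] (f : ℕ → ℕ) (ρ : Execution V P r) : Prop :=
  ∀ i < r, ρ.ty i = .reconf → dist (ρ.cfg i) (ρ.cfg (i + 1)) ≤ f (Fintype.card V)

/-- The number of communication steps of an execution. -/
def Execution.nbcomm (ρ : Execution V P r) : ℕ :=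
  ((Finset.range r).filter (fun i => ρ.ty i = StepType.comm)).card

/-- The total number of edge reconfigurations along an execution. -/
noncomputable def Execution.nbreconfig (ρ : Execution V P r) : ℕ :=
  ∑ i ∈ (Finset.range r).filter (fun i => ρ.ty i = StepType.reconf),
    dist (ρ.cfg i) (ρ.cfg (i + 1))

/-- An execution is `k`-balanced if it starts and ends with a communication step
and `nbreconfig ρ ≤ k * (nbcomm ρ - 1)`. -/
def Execution.Balanced (k : ℕ) (ρ : Execution V P r) : Prop :=
  1 ≤ r ∧ ρ.ty 0 = StepType.comm ∧ ρ.ty (r - 1) = StepType.comm ∧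
    ρ.nbreconfig ≤ k * (ρ.nbcomm - 1)

/-- Juxtaposition `G ⊕ H` of two configurations: disjoint union. -/
def Config.juxt {V W Q : Type} (G : Config V Q) (H : Config W Q) : Config (V ⊕ W) Q where
  graph := SimpleGraph.fromEdgeSet
    (Sym2.map Sum.inl '' G.graph.edgeSet ∪ Sym2.map Sum.inr '' H.graph.edgeSet)
  label := Sum.elim G.label H.label

/-- `G ^ N`: juxtaposition of `N` disjoint copies of `G`. -/
def Config.pow {V Q : Type} (G : Config V Q) (N : ℕ) : Config (V × Fin N) Q where
  graph := SimpleGraph.fromEdgeSet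
    (⋃ i : Fin N, Sym2.map (fun v => (v, i)) '' G.graph.edgeSet)
  label := fun p => G.label p.1

/-- Renaming the nodes of a configuration along a bijection. -/
def Config.rename {V W Q : Type} (e : V ≃ W) (G : Config V Q) : Config W Q where
  graph := SimpleGraph.comap e.symm G.graph
  label := G.label ∘ e.symm


variable {Q M V : Type} {P : BroadcastProtocol Q M} {r : ℕ}

/-- The potential of a `1`-balanced execution: `p 0 = 0`, a communication step adds `1`,
and a reconfiguration step subtracts the number of reconfigured edges. -/
noncomputable def Execution.potential (ρ : Execution V P r) : ℕ → ℤ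
  | 0 => 0
  | i + 1 => ρ.potential i +
      (if ρ.ty i = StepType.comm then 1 else -(dist (ρ.cfg i) (ρ.cfg (i + 1)) : ℤ))

/-- The potential keeps a constant sign on the segment of indices `[b, e]`. -/
def Execution.SignConst (ρ : Execution V P r) (b e : ℕ) : Prop :=
  ∀ l l', b ≤ l → l ≤ l' → l' ≤ e → 0 ≤ ρ.potential l * ρ.potential l'

/-- `G_b ⋯ G_e` is a phase of `ρ = (G_i)_{0 ≤ i ≤ r}`: a maximal segment of the prefix
`(G_i)_{0 ≤ i ≤ r - 1}` along which the potential keeps a constant sign. -/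
def Execution.IsPhase (ρ : Execution V P r) (b e : ℕ) : Prop :=
  b ≤ e ∧ e ≤ r - 1 ∧ ρ.SignConst b e ∧
    (b = 0 ∨ ¬ ρ.SignConst (b - 1) e) ∧
    (e = r - 1 ∨ ¬ ρ.SignConst b (e + 1))

/-! ### Reconfigurations of a single configuration -/

lemma dist_self_eq_zero (G : Config V Q) : dist G G = 0 := by
  simp [dist]

lemma exists_reconf_of_dist_eq_succ {G H : Config V Q} {d : ℕ} (hGH : ReconfStep G H)
    (hd : dist G H = d + 1) :
    ∃ K, ReconfStep G K ∧ dist G K = 1 ∧ ReconfStep K H ∧ dist K H = d := by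
  have hne : (symmDiff G.graph.edgeSet H.graph.edgeSet).Nonempty := by
    apply Set.nonempty_of_ncard_ne_zero
    unfold dist at hd
    omega
  obtain ⟨a, ha⟩ := hne
  have hdiag : a ∉ Sym2.diagSet := by
    intro h
    rcases ha with ha | ha
    · exact G.graph.not_isDiag_of_mem_edgeSet ha.1 (by simpa using h)
    · exact H.graph.not_isDiag_of_mem_edgeSet ha.1 (by simpa using h)
  let K : Config V Q := ⟨SimpleGraph.fromEdgeSet (symmDiff G.graph.edgeSet {a}), G.label⟩
  have hK : K.graph.edgeSet = symmDiff G.graph.edgeSet {a} := by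
    have hdisj : Disjoint (symmDiff G.graph.edgeSet {a}) Sym2.diagSet := by
      rw [Set.disjoint_left]
      rintro x (hx | hx) hxd
      · exact G.graph.not_isDiag_of_mem_edgeSet hx.1 (by simpa using hxd)
      · rw [Set.mem_singleton_iff.1 hx.1] at hxd
        exact hdiag hxd
    simpa [K, SimpleGraph.edgeSet_fromEdgeSet] using hdisj
  refine ⟨K, rfl, ?_, hGH, ?_⟩
  · unfold dist
    rw [hK, symmDiff_symmDiff_cancel_left, Set.ncard_singleton]
  · have hKH : symmDiff K.graph.edgeSet H.graph.edgeSet =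
        symmDiff G.graph.edgeSet H.graph.edgeSet \ {a} := by
      rw [hK]
      ext x
      by_cases hx : x = a
      · subst hx
        simp only [Set.mem_symmDiff, Set.mem_sdiff, Set.mem_singleton_iff] at ha ⊢
        tauto
      · simp only [Set.mem_symmDiff, Set.mem_sdiff, Set.mem_singleton_iff, hx]
        tauto
    unfold dist at hd ⊢
    rw [hKH, Set.ncard_sdiff_singleton_of_mem ha, hd]
    rfl

/-! ### Families of configurations -/

section Family

variable {J : Type} [Fintype J]

/-- One member of the family performs a communication step. -/
def FamComm (P : BroadcastProtocol Q M) (f g : J → Config V Q) : Prop :=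
  ∃ j, CommStep P (f j) (g j) ∧ ∀ i, i ≠ j → g i = f i

/-- The members of the family reconfigure at most `d` edges in total. -/
def FamReconf (d : ℕ) (f g : J → Config V Q) : Prop :=
  (∀ j, ReconfStep (f j) (g j)) ∧ ∑ j, dist (f j) (g j) ≤ d

/-- A communication step of one member followed by the reconfiguration of at most one edge. -/
def FamRound (P : BroadcastProtocol Q M) (f g : J → Config V Q) : Prop :=
  ∃ h, FamComm P f h ∧ FamReconf 1 h g

/-- `FamSched P k f g`: the family can evolve from `f` to `g` by rounds, with the help of `k`
communication steps performed outside of the family. -/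
inductive FamSched (P : BroadcastProtocol Q M) : ℕ → (J → Config V Q) → (J → Config V Q) → Prop
  | reconf {f g} : FamReconf 0 f g → FamSched P 0 f g
  | round {k f g h} : FamSched P k f g → FamRound P g h → FamSched P k f h
  | borrow {k f g h} : FamSched P k f g → FamReconf 1 g h → FamSched P (k + 1) f h

omit [Fintype J] in
lemma FamComm.cons {n : ℕ} {f g : Fin n → Config V Q} (h : FamComm P f g) (G : Config V Q) :
    FamComm P (Fin.cons G f : Fin (n + 1) → Config V Q) (Fin.cons G g) := by
  obtain ⟨j, hj, hne⟩ := h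
  refine ⟨j.succ, by simpa using hj, fun i => ?_⟩
  refine Fin.cases (fun _ => by simp) (fun i hi => ?_) i
  simpa using hne i (fun h => hi (by rw [h]))

lemma FamComm.cons_head {n : ℕ} {G H : Config V Q} (h : CommStep P G H)
    (f : Fin n → Config V Q) :
    FamComm P (Fin.cons G f : Fin (n + 1) → Config V Q) (Fin.cons H f) := by
  refine ⟨0, by simpa using h, fun i => ?_⟩
  exact Fin.cases (fun h => absurd rfl h) (fun i _ => by simp) i

lemma FamReconf.cons {n d d' : ℕ} {G H : Config V Q} {f g : Fin n → Config V Q}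
    (hGH : ReconfStep G H) (hd : dist G H = d) (h : FamReconf d' f g) :
    FamReconf (d + d') (Fin.cons G f : Fin (n + 1) → Config V Q) (Fin.cons H g) := by
  refine ⟨fun i => ?_, ?_⟩
  · exact Fin.cases (by simpa using hGH) (fun i => by simpa using h.1 i) i
  · have := h.2
    simp only [Fin.sum_univ_succ, Fin.cons_zero, Fin.cons_succ]
    omega

lemma FamReconf.refl (d : ℕ) (f : J → Config V Q) : FamReconf d f f :=
  ⟨fun _ => rfl, by simp [dist_self_eq_zero]⟩

lemma FamReconf.cons_zero_dist {n d : ℕ} {G H : Config V Q} {f g : Fin n → Config V Q}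
    (hGH : ReconfStep G H) (hd : dist G H = 0) (h : FamReconf d f g) :
    FamReconf d (Fin.cons G f : Fin (n + 1) → Config V Q) (Fin.cons H g) := by
  simpa using FamReconf.cons hGH hd h

lemma FamRound.cons {n : ℕ} {f g : Fin n → Config V Q} (h : FamRound P f g) (G : Config V Q) :
    FamRound P (Fin.cons G f : Fin (n + 1) → Config V Q) (Fin.cons G g) := by
  obtain ⟨h, hc, hr⟩ := h
  exact ⟨Fin.cons G h, hc.cons G, hr.cons_zero_dist rfl (dist_self_eq_zero G)⟩

lemma FamSched.round_trans {k : ℕ} {f g h : J → Config V Q} (hs : FamSched P k f g)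
    (hr : Relation.ReflTransGen (FamRound P) g h) : FamSched P k f h := by
  induction hr with
  | refl => exact hs
  | tail _ hstep ih => exact ih.round hstep

lemma FamRound.cons_reflTransGen {n : ℕ} {f g : Fin n → Config V Q}
    (h : Relation.ReflTransGen (FamRound P) f g) (G : Config V Q) :
    Relation.ReflTransGen (FamRound P) (Fin.cons G f : Fin (n + 1) → Config V Q)
      (Fin.cons G g) :=
  h.lift (fun f : Fin n → Config V Q => (Fin.cons G f : Fin (n + 1) → Config V Q))
    (fun _ _ h => h.cons G)

lemma FamSched.exists_of_zero {f g : J → Config V Q} (h : FamSched P 0 f g) :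
    ∃ f', FamReconf 0 f f' ∧ Relation.ReflTransGen (FamRound P) f' g := by
  generalize hk : 0 = k at h
  induction h with
  | reconf h => exact ⟨_, h, .refl⟩
  | round _ hr ih =>
    obtain ⟨f', h₁, h₂⟩ := ih hk
    exact ⟨f', h₁, h₂.tail hr⟩
  | borrow => omega

lemma FamSched.exists_of_succ {k : ℕ} {f g : J → Config V Q} (h : FamSched P (k + 1) f g) :
    ∃ f' g', FamSched P k f f' ∧ FamReconf 1 f' g' ∧
      Relation.ReflTransGen (FamRound P) g' g := by
  generalize hk : k + 1 = k' at h
  induction h with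
  | reconf h => omega
  | round _ hr ih =>
    obtain ⟨f', g', h₁, h₂, h₃⟩ := ih hk
    exact ⟨f', g', h₁, h₂, h₃.tail hr⟩
  | borrow hs hr =>
    obtain rfl := Nat.succ_injective hk
    exact ⟨_, _, hs, hr, .refl⟩

lemma FamSched.cons_reconf_of_dist_eq_succ {n k d : ℕ} {F : Fin (n + 1) → Config V Q}
    {g : Fin n → Config V Q} {G H : Config V Q} (hs : FamSched P k F (Fin.cons G g))
    (hGH : ReconfStep G H) (hd : dist G H = d + 1) :
    FamSched P (k + (d + 1)) F (Fin.cons H g) := by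
  induction d generalizing k G with
  | zero => exact hs.borrow (FamReconf.cons hGH hd (FamReconf.refl 0 g))
  | succ d ih =>
    obtain ⟨K, hGK, hd₁, hKH, hd₂⟩ := exists_reconf_of_dist_eq_succ hGH hd
    have := ih (hs.borrow (FamReconf.cons hGK hd₁ (FamReconf.refl 0 g))) hKH hd₂
    rwa [show k + (d + 1 + 1) = k + 1 + (d + 1) by ring]

/-- A reconfiguration of cost `d` splits into one of cost `0` and `d` elementary ones. The former
matters because a reconfiguration of infinitely many edges has cost `0`. -/
lemma exists_reconf_dist_zero {G H : Config V Q} (hGH : ReconfStep G H) :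
    ∃ K, ReconfStep G K ∧ dist G K = 0 ∧
      ∀ (P : BroadcastProtocol Q M) {n k : ℕ} {F : Fin (n + 1) → Config V Q}
        {g : Fin n → Config V Q}, FamSched P k F (Fin.cons K g) →
          FamSched P (k + dist G H) F (Fin.cons H g) := by
  rcases hd : dist G H with _ | d
  · exact ⟨H, hGH, hd, fun _ _ _ _ _ hs => hs⟩
  · exact ⟨G, rfl, dist_self_eq_zero G,
      fun _ _ _ _ _ hs => hs.cons_reconf_of_dist_eq_succ hGH hd⟩

/-- `Segment P c d G H`: a piece of execution from `G` to `H` with `c` communication steps and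
`d` edge reconfigurations, in which every communication step is followed by a (possibly trivial)
reconfiguration step. -/
inductive Segment (P : BroadcastProtocol Q M) : ℕ → ℕ → Config V Q → Config V Q → Prop
  | reconf {G H} : ReconfStep G H → Segment P 0 (dist G H) G H
  | step {c d G H K L} : Segment P c d G H → CommStep P H K → ReconfStep K L →
      Segment P (c + 1) (d + dist K L) G L

/-- A new member of the family can provide the external communication steps, provided its own
reconfigurations are in turn helped by external communication steps. -/
lemma FamSched.cons_segment {n k c d : ℕ} {f g : Fin n → Config V Q} {G H : Config V Q}
    (hs : FamSched P k f g) (hseg : Segment P c d G H) (hk : k ≤ c) :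
    FamSched P d (Fin.cons G f : Fin (n + 1) → Config V Q) (Fin.cons H g) := by
  induction hseg generalizing k g with
  | @reconf G H hGH =>
    obtain rfl : k = 0 := by omega
    obtain ⟨f', hf, hr⟩ := hs.exists_of_zero
    obtain ⟨K, hGK, hd, hK⟩ := exists_reconf_dist_zero (M := M) hGH
    have h₁ : FamSched P 0 (Fin.cons G f : Fin (n + 1) → Config V Q) (Fin.cons K f') :=
      .reconf (hf.cons_zero_dist hGK hd)
    simpa using (hK P h₁).round_trans (FamRound.cons_reflTransGen hr H)
  | @step c d G H K L _ hHK hKL ih =>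
    obtain ⟨K', hKK', hd, hK'⟩ := exists_reconf_dist_zero (M := M) hKL
    obtain ⟨g₁, g₂, h₁, h₂, h₃⟩ : ∃ g₁ g₂,
        FamSched P d (Fin.cons G f : Fin (n + 1) → Config V Q) (Fin.cons H g₁) ∧
        FamReconf 1 g₁ g₂ ∧ Relation.ReflTransGen (FamRound P) g₂ g := by
      rcases Nat.lt_or_eq_of_le hk with hk | rfl
      · exact ⟨g, g, ih hs (by omega), FamReconf.refl 1 g, .refl⟩
      · obtain ⟨g₁, g₂, h₁, h₂, h₃⟩ := hs.exists_of_succ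
        exact ⟨g₁, g₂, ih h₁ le_rfl, h₂, h₃⟩
    have h₄ := h₁.round ⟨_, FamComm.cons_head hHK g₁, h₂.cons_zero_dist hKK' hd⟩
    exact (hK' P h₄).round_trans (FamRound.cons_reflTransGen h₃ L)

lemma Segment.famSched {c d : ℕ} {G H : Config V Q} (hseg : Segment P c d G H) (hd : d ≤ c)
    (N : ℕ) : FamSched P d (fun _ : Fin N => G) (fun _ => H) := by
  induction N with
  | zero =>
    have key : ∀ k, ∀ f g : Fin 0 → Config V Q, FamSched P k f g := by
      intro k f g
      induction k with
      | zero => exact .reconf ⟨fun j => j.elim0, by simp⟩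
      | succ k ih => exact ih.borrow (Subsingleton.elim g g ▸ FamReconf.refl 1 g)
    exact key d _ _
  | succ N ih =>
    have hconst : ∀ G : Config V Q,
        (Fin.cons G (fun _ => G) : Fin (N + 1) → Config V Q) = fun _ => G := by
      intro G
      funext i
      exact Fin.cases rfl (fun _ => rfl) i
    simpa only [hconst] using ih.cons_segment hseg hd

/-- `k` extra copies of a configuration, each able to perform one communication step, provide the
external communication steps of a schedule. -/
lemma FamSched.sumElim {κ k : ℕ} {f g : J → Config V Q} {A B : Config V Q}
    (hAB : CommStep P A B) (hs : FamSched P k f g) (hk : k ≤ κ) :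
    ∃ h, FamReconf 0 (Sum.elim (fun _ : Fin κ => A) f) h ∧
      Relation.ReflTransGen (FamRound P) h
        (Sum.elim (fun i : Fin κ => if i.1 < k then B else A) g) := by
  have hrec : ∀ (x : Fin κ → Config V Q) {d : ℕ} {f g : J → Config V Q}, FamReconf d f g →
      FamReconf d (Sum.elim x f) (Sum.elim x g) := by
    intro x d f g h
    refine ⟨fun j => ?_, ?_⟩
    · rcases j with j | j
      · rfl
      · exact h.1 j
    · simpa [Fintype.sum_sum_type, dist_self_eq_zero] using h.2
  induction hs with
  | reconf h => exact ⟨_, hrec _ h, by simpa using .refl⟩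
  | round _ hr ih =>
    obtain ⟨h, h₁, h₂⟩ := ih hk
    refine ⟨h, h₁, h₂.tail ?_⟩
    obtain ⟨l, ⟨j, hj, hne⟩, hl⟩ := hr
    refine ⟨Sum.elim _ l, ⟨.inr j, hj, ?_⟩, hrec _ hl⟩
    rintro (i | i) hi
    · rfl
    · exact hne i (fun h => hi (by rw [h]))
  | @borrow k f g g' _ hr ih =>
    obtain ⟨h, h₁, h₂⟩ := ih (by omega)
    refine ⟨h, h₁, h₂.tail ⟨Sum.elim _ g, ⟨.inl ⟨k, hk⟩, ?_, ?_⟩, hrec _ hr⟩⟩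
    · simpa using hAB
    · rintro (i | i) hi
      · have : i.1 ≠ k := fun h => hi (by simp [← h])
        simp only [Sum.elim_inl]
        congr 1
        simp only [eq_iff_iff]
        omega
      · rfl

/-! ### From families of configurations to configurations -/

/-- The disjoint union of a family of configurations. -/
def assemble {X : Type} (φ : X ≃ V × J) (f : J → Config V Q) : Config X Q where
  graph :=
    { Adj x y := (φ x).2 = (φ y).2 ∧ (f (φ x).2).graph.Adj (φ x).1 (φ y).1
      symm := ⟨fun _ _ h => ⟨h.1.symm, h.1 ▸ h.2.symm⟩⟩
      loopless := ⟨fun x h => (f (φ x).2).graph.loopless.irrefl _ h.2⟩ }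
  label := fun x => (f (φ x).2).label (φ x).1

variable {X : Type} (φ : X ≃ V × J)

omit [Fintype J] in
lemma FamComm.assemble {f g : J → Config V Q} (h : FamComm P f g) :
    CommStep P (assemble φ f) (assemble φ g) := by
  obtain ⟨j, ⟨hgr, v, m, hv, hn, ho⟩, hne⟩ := h
  have hgraph : ∀ i, (g i).graph = (f i).graph := by
    intro i
    by_cases hi : i = j
    · rw [hi, hgr]
    · rw [hne i hi]
  refine ⟨?_, φ.symm (v, j), m, ?_, ?_, ?_⟩
  · ext x y
    simp [RBN.assemble, hgraph]
  · simpa [RBN.assemble] using hv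
  · rintro u ⟨hu, hadj⟩
    simp only [Equiv.apply_symm_apply] at hu hadj
    simpa [RBN.assemble, ← hu] using hn _ hadj
  · intro u hu hadj
    by_cases hi : (φ u).2 = j
    · have h₁ : (φ u).1 ≠ v := by
        rintro rfl
        exact hu (by simp [← hi])
      have h₂ : ¬ (f j).graph.Adj v (φ u).1 := by
        intro h
        exact hadj ⟨by simpa using hi.symm, by simpa using h⟩
      simpa [RBN.assemble, hi] using ho _ h₁ h₂
    · simp [RBN.assemble, hne _ hi]

lemma dist_assemble_le (f g : J → Config V Q) :
    dist (assemble φ f) (assemble φ g) ≤ ∑ j, dist (f j) (g j) := by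
  have hset : symmDiff (assemble φ f).graph.edgeSet (assemble φ g).graph.edgeSet =
      ⋃ j ∈ (Finset.univ : Finset J), Sym2.map (fun v => φ.symm (v, j)) ''
        symmDiff (f j).graph.edgeSet (g j).graph.edgeSet := by
    ext a
    induction a using Sym2.ind with
    | _ x y =>
    simp only [Set.mem_iUnion, Set.mem_image, Finset.mem_univ, exists_prop, true_and]
    constructor
    · intro h
      have hxy : (φ x).2 = (φ y).2 := by
        rcases h with h | h
        · exact h.1.1
        · exact h.1.1
      refine ⟨(φ x).2, s((φ x).1, (φ y).1), ?_, ?_⟩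
      · simpa [Set.mem_symmDiff, assemble, hxy] using h
      · have : ((φ y).1, (φ x).2) = φ y := by rw [hxy]
        simp [this]
    · rintro ⟨j, b, hb, hab⟩
      induction b using Sym2.ind with
      | _ u v =>
      rw [← hab]
      simpa [Set.mem_symmDiff, assemble] using hb
  unfold dist
  rw [hset]
  refine (Finset.set_ncard_biUnion_le _ _).trans (Finset.sum_le_sum fun j _ => ?_)
  refine (Set.ncard_image_of_injective _ (Sym2.map.injective ?_)).le
  intro u v h
  simpa using h

lemma FamReconf.assemble {d : ℕ} {f g : J → Config V Q} (h : FamReconf d f g) :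
    ReconfStep (assemble φ f) (assemble φ g) ∧ dist (assemble φ f) (assemble φ g) ≤ d := by
  refine ⟨?_, (dist_assemble_le φ f g).trans h.2⟩
  funext x
  exact congrFun (h.1 (φ x).2) (φ x).1

lemma juxt_pow_eq_assemble (κ N : ℕ) (G H : Config V Q) :
    Config.juxt (G.pow κ) (H.pow N) =
      assemble (Equiv.prodSumDistrib V (Fin κ) (Fin N)).symm
        (Sum.elim (fun _ => G) (fun _ => H)) := by
  have hpow : ∀ (G : Config V Q) (N : ℕ) (x y : V × Fin N),
      (G.pow N).graph.Adj x y ↔ x.2 = y.2 ∧ G.graph.Adj x.1 y.1 := by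
    rintro G N ⟨u, i⟩ ⟨v, j⟩
    simp only [Config.pow, SimpleGraph.fromEdgeSet_adj, Set.mem_iUnion, Set.mem_image]
    constructor
    · rintro ⟨⟨k, a, ha, hk⟩, -⟩
      induction a using Sym2.ind with
      | _ p q =>
      simp only [Sym2.map_mk, Sym2.eq_iff, Prod.mk.injEq] at hk
      rcases hk with ⟨⟨rfl, rfl⟩, rfl, rfl⟩ | ⟨⟨rfl, rfl⟩, rfl, rfl⟩
      · exact ⟨rfl, ha⟩
      · exact ⟨rfl, ha.symm⟩
    · rintro ⟨hij, hadj⟩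
      obtain rfl : i = j := hij
      exact ⟨⟨i, s(u, v), hadj, rfl⟩, fun h => hadj.ne (congrArg Prod.fst h)⟩
  have hjuxt : ∀ {W W' : Type} (G : Config W Q) (H : Config W' Q) (x y : W ⊕ W'),
      (G.juxt H).graph.Adj x y ↔
        (∃ u v, x = .inl u ∧ y = .inl v ∧ G.graph.Adj u v) ∨
        (∃ u v, x = .inr u ∧ y = .inr v ∧ H.graph.Adj u v) := by
    intro W W' G H x y
    simp only [Config.juxt, SimpleGraph.fromEdgeSet_adj, Set.mem_union, Set.mem_image]
    constructor
    · rintro ⟨⟨a, ha, hk⟩ | ⟨a, ha, hk⟩, -⟩ <;> induction a using Sym2.ind with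
      | _ p q =>
      simp only [Sym2.map_mk, Sym2.eq_iff] at hk
      rcases hk with ⟨rfl, rfl⟩ | ⟨rfl, rfl⟩
      · simp_all
      · simp_all [SimpleGraph.adj_comm]
    · rintro (⟨u, v, rfl, rfl, h⟩ | ⟨u, v, rfl, rfl, h⟩)
      · exact ⟨.inl ⟨s(u, v), h, rfl⟩, by simpa using h.ne⟩
      · exact ⟨.inr ⟨s(u, v), h, rfl⟩, by simpa using h.ne⟩
  have hext : ∀ {C D : Config ((V × Fin κ) ⊕ (V × Fin N)) Q}, C.graph = D.graph →
      C.label = D.label → C = D := by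
    rintro ⟨_, _⟩ ⟨_, _⟩ rfl rfl
    rfl
  refine hext ?_ ?_
  · ext x y
    rw [hjuxt]
    rcases x with x | x <;> rcases y with y | y <;> simp [assemble, hpow]
  · funext x
    rcases x with x | x <;> simp [assemble, Config.juxt, Config.pow]

end Family

/-! ### Building executions -/

/-- A reconfiguration step followed by rounds forms an execution. -/
lemma exists_execution_of_reflTransGen {A B C : Config V Q}
    (hAB : ReconfStep A B ∧ dist A B ≤ 1)
    (hBC : Relation.ReflTransGen
      (fun G H => ∃ K, CommStep P G K ∧ ReconfStep K H ∧ dist K H ≤ 1) B C) :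
    ∃ (r' : ℕ) (ρ' : Execution V P r'),
      ρ'.KConstrained 1 ∧ ρ'.cfg 0 = A ∧ ρ'.cfg r' = C := by
  obtain ⟨m, cfg, h0, hm, hr, hc⟩ : ∃ (m : ℕ) (cfg : ℕ → Config V Q), cfg 0 = A ∧
      cfg (2 * m + 1) = C ∧
      (∀ i < 2 * m + 1, i % 2 = 0 →
        ReconfStep (cfg i) (cfg (i + 1)) ∧ dist (cfg i) (cfg (i + 1)) ≤ 1) ∧
      (∀ i < 2 * m + 1, i % 2 = 1 → CommStep P (cfg i) (cfg (i + 1))) := by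
    induction hBC with
    | refl =>
      refine ⟨0, fun i => if i = 0 then A else B, by simp, by simp, ?_, ?_⟩
      · intro i hi _
        obtain rfl : i = 0 := by omega
        simpa using hAB
      · intro i hi _
        omega
    | @tail C D _ hCD ih =>
      obtain ⟨m, cfg, h0, hm, hr, hc⟩ := ih
      obtain ⟨K, hCK, hKD⟩ := hCD
      let cfg' : ℕ → Config V Q := fun i =>
        if i ≤ 2 * m + 1 then cfg i else if i = 2 * m + 2 then K else D
      have h₁ : ∀ i ≤ 2 * m + 1, cfg' i = cfg i := fun i hi => if_pos hi
      have h₂ : cfg' (2 * m + 2) = K := by simp [cfg']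
      have h₃ : cfg' (2 * m + 3) = D := by simp [cfg']
      refine ⟨m + 1, cfg', (h₁ 0 (by omega)).trans h0, h₃, ?_, ?_⟩
      · intro i hi hpar
        by_cases him : i < 2 * m + 1
        · rw [h₁ i (by omega), h₁ (i + 1) (by omega)]
          exact hr i him hpar
        · obtain rfl : i = 2 * m + 2 := by omega
          rwa [h₂, h₃]
      · intro i hi hpar
        by_cases him : i < 2 * m + 1
        · rw [h₁ i (by omega), h₁ (i + 1) (by omega)]
          exact hc i him hpar
        · obtain rfl : i = 2 * m + 1 := by omega
          rwa [h₁ _ le_rfl, hm, h₂]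
  refine ⟨2 * m + 1,
    { cfg := cfg
      ty := fun i => if i % 2 = 0 then .reconf else .comm
      step_comm := fun i hi h => hc i hi ?_
      step_reconf := fun i hi h => (hr i hi ?_).1
      alternate := fun i _ => ?_ }, fun i hi h => (hr i hi ?_).2, h0, hm⟩
  · by_contra hpar
    simp [show i % 2 = 0 by omega] at h
  · by_contra hpar
    simp [hpar] at h
  · rcases Nat.mod_two_eq_zero_or_one i with hpar | hpar
    · simp [hpar, show (i + 1) % 2 = 1 by omega]
    · simp [hpar, show (i + 1) % 2 = 0 by omega]
  · by_contra hpar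
    simp [hpar] at h

/-- Copies of a segment with at least as many communication steps as edge reconfigurations can be
scheduled in a `1`-constrained way with the help of as many extra copies as there are edge
reconfigurations. -/
lemma Segment.exists_execution {c d : ℕ} {A B G H : Config V Q} (hAB : CommStep P A B)
    (hseg : Segment P c d G H) (hd : d ≤ c) (N : ℕ) :
    ∃ (r' : ℕ) (ρ' : Execution ((V × Fin d) ⊕ (V × Fin N)) P r'),
      ρ'.KConstrained 1 ∧ ρ'.cfg 0 = Config.juxt (A.pow d) (G.pow N) ∧
      ρ'.cfg r' = Config.juxt (B.pow d) (H.pow N) := by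
  obtain ⟨h, h₁, h₂⟩ := (hseg.famSched hd N).sumElim hAB le_rfl
  have hB : (fun i : Fin d => if i.1 < d then B else A) = fun _ => B := by
    funext i
    exact if_pos i.2
  rw [hB] at h₂
  rw [juxt_pow_eq_assemble, juxt_pow_eq_assemble]
  set φ := (Equiv.prodSumDistrib V (Fin d) (Fin N)).symm
  have h₁' := h₁.assemble φ
  refine exists_execution_of_reflTransGen ⟨h₁'.1, h₁'.2.trans zero_le_one⟩
    (h₂.lift (assemble φ) ?_)
  rintro f g ⟨l, hc, hr⟩
  exact ⟨assemble φ l, hc.assemble φ, hr.assemble φ⟩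

/-! ### The potential of a balanced execution -/

lemma Execution.ty_eq_comm_iff (ρ : Execution V P r) (h0 : ρ.ty 0 = .comm) {i : ℕ}
    (hi : i < r) : ρ.ty i = .comm ↔ i % 2 = 0 := by
  induction i with
  | zero => simp [h0]
  | succ i ih =>
    have h₁ := ρ.alternate i hi
    have h₂ := ih (by omega)
    have h₃ : ρ.ty (i + 1) = .comm ↔ ¬ ρ.ty i = .comm := by
      cases h : ρ.ty i <;> cases h' : ρ.ty (i + 1) <;> simp_all
    rw [h₃, h₂]
    omega

lemma Execution.ty_eq_reconf (ρ : Execution V P r) (h0 : ρ.ty 0 = .comm) {i : ℕ}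
    (hi : i < r) (hpar : i % 2 = 1) : ρ.ty i = .reconf := by
  have := ρ.ty_eq_comm_iff h0 hi
  cases h : ρ.ty i
  · have := this.1 h
    omega
  · rfl

lemma Execution.potential_succ_of_even (ρ : Execution V P r) (h0 : ρ.ty 0 = .comm) {i : ℕ}
    (hi : i < r) (hpar : i % 2 = 0) : ρ.potential (i + 1) = ρ.potential i + 1 := by
  rw [potential, if_pos ((ρ.ty_eq_comm_iff h0 hi).2 hpar)]

lemma Execution.potential_succ_of_odd (ρ : Execution V P r) (h0 : ρ.ty 0 = .comm) {i : ℕ}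
    (hi : i < r) (hpar : i % 2 = 1) :
    ρ.potential (i + 1) = ρ.potential i - dist (ρ.cfg i) (ρ.cfg (i + 1)) := by
  rw [potential, ρ.ty_eq_reconf h0 hi hpar, if_neg (by simp), sub_eq_add_neg]

lemma Execution.potential_eq (ρ : Execution V P r) :
    ρ.potential r = (ρ.nbcomm : ℤ) - ρ.nbreconfig := by
  unfold nbcomm nbreconfig
  suffices h : ∀ i, ρ.potential i =
      (((Finset.range i).filter (fun i => ρ.ty i = StepType.comm)).card : ℤ) -
        ((∑ i ∈ (Finset.range i).filter (fun i => ρ.ty i = StepType.reconf),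
          dist (ρ.cfg i) (ρ.cfg (i + 1)) : ℕ) : ℤ) from h r
  intro i
  induction i with
  | zero => simp [potential]
  | succ i ih =>
    rw [potential, ih, Finset.range_add_one, Finset.filter_insert, Finset.filter_insert]
    cases h : ρ.ty i
    · simp
      ring
    · simp
      ring

lemma Execution.Balanced.potential_pred_nonneg {ρ : Execution V P r} (h : ρ.Balanced 1) :
    0 ≤ ρ.potential (r - 1) := by
  obtain ⟨hr, h0, hlast, hle⟩ := h
  have h₁ := ρ.potential_succ_of_even h0 (i := r - 1) (by omega)
    ((ρ.ty_eq_comm_iff h0 (by omega)).1 hlast)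
  rw [Nat.sub_add_cancel hr, ρ.potential_eq] at h₁
  have h₂ : 0 < ρ.nbcomm := Finset.card_pos.2 ⟨0, by simp [h0]; omega⟩
  omega

/-- A piece of an execution starting with a communication step is a segment, and the variation of
the potential along it counts the communication steps minus the reconfigurations. -/
lemma Execution.exists_segment (ρ : Execution V P r) (h0 : ρ.ty 0 = .comm) {b e : ℕ}
    (hbe : b ≤ e) (he : e ≤ r) :
    ∃ d : ℕ, ρ.potential e - ρ.potential b = (((e + 1) / 2 - (b + 1) / 2 : ℕ) : ℤ) - d ∧
      Segment P ((e + 1) / 2 - (b + 1) / 2) d (ρ.cfg b) (ρ.cfg e) := by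
  suffices h : ∃ d : ℕ,
      ρ.potential e - ρ.potential b = (((e + 1) / 2 - (b + 1) / 2 : ℕ) : ℤ) - d ∧
      Segment P ((e + 1) / 2 - (b + 1) / 2) d (ρ.cfg b) (ρ.cfg e) ∧
      (e % 2 = 1 → ∀ K, ReconfStep (ρ.cfg e) K →
        Segment P ((e + 1) / 2 - (b + 1) / 2) (d + dist (ρ.cfg e) K) (ρ.cfg b) K) by
    obtain ⟨d, h₁, h₂, -⟩ := h
    exact ⟨d, h₁, h₂⟩
  induction e, hbe using Nat.le_induction with
  | base =>
    have h₁ : Segment P 0 (dist (ρ.cfg b) (ρ.cfg b)) (ρ.cfg b) (ρ.cfg b) := .reconf rfl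
    rw [dist_self_eq_zero] at h₁
    refine ⟨0, by simp, by simpa using h₁, fun _ K hK => ?_⟩
    simpa using Segment.reconf (P := P) hK
  | succ e hbe ih =>
    obtain ⟨d, hp, hs, hodd⟩ := ih (by omega)
    rcases Nat.mod_two_eq_zero_or_one e with hpar | hpar
    · have hcount : (e + 1 + 1) / 2 - (b + 1) / 2 = (e + 1) / 2 - (b + 1) / 2 + 1 := by omega
      have hcomm := ρ.step_comm e (by omega) ((ρ.ty_eq_comm_iff h0 (by omega)).2 hpar)
      have hpot := ρ.potential_succ_of_even h0 (by omega) hpar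
      rw [hcount]
      refine ⟨d, ?_, ?_, fun _ K hK => hs.step hcomm hK⟩
      · push_cast
        linarith
      · simpa [dist_self_eq_zero] using
          hs.step hcomm (show ReconfStep (ρ.cfg (e + 1)) (ρ.cfg (e + 1)) from rfl)
    · have hcount : (e + 1 + 1) / 2 - (b + 1) / 2 = (e + 1) / 2 - (b + 1) / 2 := by omega
      have hrec := ρ.step_reconf e (by omega) (ρ.ty_eq_reconf h0 (by omega) hpar)
      have hpot := ρ.potential_succ_of_odd h0 (by omega) hpar
      rw [hcount]
      refine ⟨d + dist (ρ.cfg e) (ρ.cfg (e + 1)), ?_, hodd hpar _ hrec, by omega⟩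
      push_cast
      linarith

lemma Execution.SignConst.nonneg_or_nonpos {ρ : Execution V P r} {b e : ℕ}
    (h : ρ.SignConst b e) :
    (∀ i, b ≤ i → i ≤ e → 0 ≤ ρ.potential i) ∨ (∀ i, b ≤ i → i ≤ e → ρ.potential i ≤ 0) := by
  by_contra! hcon
  obtain ⟨⟨i, hbi, hie, hi⟩, j, hbj, hje, hj⟩ := hcon
  rcases le_total i j with hij | hij
  · nlinarith [h i j hbi hij hje]
  · nlinarith [h j i hbj hij hie]

lemma Execution.signConst_of_nonneg {ρ : Execution V P r} {b e : ℕ}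
    (h : ∀ i, b ≤ i → i ≤ e → 0 ≤ ρ.potential i) : ρ.SignConst b e :=
  fun l l' hl hll' hl' => mul_nonneg (h l hl (by omega)) (h l' (by omega) hl')

lemma Execution.signConst_of_nonpos {ρ : Execution V P r} {b e : ℕ}
    (h : ∀ i, b ≤ i → i ≤ e → ρ.potential i ≤ 0) : ρ.SignConst b e :=
  fun l l' hl hll' hl' => mul_nonneg_of_nonpos_of_nonpos (h l hl (by omega)) (h l' (by omega) hl')

/-- In a phase there are at most as many edge reconfigurations as communication steps, and at most
half as many as steps. -/
lemma Execution.IsPhase.reconf_le {ρ : Execution V P r} (hbal : ρ.Balanced 1) {b e : ℕ}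
    (h : ρ.IsPhase b e) {d : ℕ}
    (hd : ρ.potential e - ρ.potential b = (((e + 1) / 2 - (b + 1) / 2 : ℕ) : ℤ) - d) :
    d ≤ (e + 1) / 2 - (b + 1) / 2 ∧ d ≤ (e - b) / 2 := by
  have hlast := hbal.potential_pred_nonneg
  obtain ⟨hr, h0, hend, -⟩ := hbal
  have hrpar := (ρ.ty_eq_comm_iff h0 (by omega)).1 hend
  obtain ⟨hbe, her, hsign, hleft, hright⟩ := h
  rcases hsign.nonneg_or_nonpos with hpos | hneg
  · have hb : ρ.potential b = 0 ∧ (b = 0 ∨ b % 2 = 1) := by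
      rcases Nat.eq_zero_or_pos b with rfl | hb0
      · exact ⟨rfl, .inl rfl⟩
      have hprev : ρ.potential (b - 1) < 0 := by
        by_contra! hprev
        refine (hleft.resolve_left (by omega)) (signConst_of_nonneg fun i hi hie => ?_)
        rcases Nat.eq_or_lt_of_le hi with rfl | hi
        · exact hprev
        · exact hpos i (by omega) hie
      have hcur := hpos b le_rfl hbe
      rcases Nat.mod_two_eq_zero_or_one (b - 1) with hpar | hpar
      · have := ρ.potential_succ_of_even h0 (by omega) hpar
        rw [Nat.sub_add_cancel hb0] at this
        omega
      · have := ρ.potential_succ_of_odd h0 (by omega) hpar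
        rw [Nat.sub_add_cancel hb0] at this
        omega
    obtain ⟨hb, hbpar⟩ := hb
    have he := hpos e hbe le_rfl
    by_cases hpar : b = 0 ∧ e % 2 = 1
    · have h₁ := ρ.potential_succ_of_even h0 (i := e - 1) (by omega) (by omega)
      rw [Nat.sub_add_cancel (by omega)] at h₁
      have h₂ := hpos (e - 1) (by omega) (by omega)
      omega
    · omega
  · have he : 0 ≤ ρ.potential e ∧ e % 2 = 0 := by
      by_cases hlast' : e = r - 1
      · exact ⟨hlast' ▸ hlast, hlast' ▸ hrpar⟩
      have hnext : 0 < ρ.potential (e + 1) := by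
        by_contra! hnext
        refine (hright.resolve_left hlast') (signConst_of_nonpos fun i hi hie => ?_)
        rcases Nat.eq_or_lt_of_le hie with rfl | hie
        · exact hnext
        · exact hneg i hi (by omega)
      have hcur := hneg e hbe le_rfl
      rcases Nat.mod_two_eq_zero_or_one e with hpar | hpar
      · have := ρ.potential_succ_of_even h0 (by omega) hpar
        omega
      · have := ρ.potential_succ_of_odd h0 (by omega) hpar
        omega
    have hb := hneg b le_rfl hbe
    omega

/-- Lemma on phases.
For any phase `G_b ⋯ G_e` of a `1`-balanced execution `ρ = (G_i)_{0 ≤ i ≤ n}`, there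
exists `κ ≤ (e - b)/2` such that for every `N` there is a `1`-constrained execution
from `G_0^κ ⊕ G_b^N` to `G_1^κ ⊕ G_e^N`. -/
theorem phase_lemma {n : ℕ} (ρ : Execution V P n) (hbal : ρ.Balanced 1)
    (b e : ℕ) (hphase : ρ.IsPhase b e) :
    ∃ κ ≤ (e - b) / 2, ∀ N : ℕ,
      ∃ (r' : ℕ) (ρ' : Execution ((V × Fin κ) ⊕ (V × Fin N)) P r'),
        ρ'.KConstrained 1 ∧
        ρ'.cfg 0 = Config.juxt ((ρ.cfg 0).pow κ) ((ρ.cfg b).pow N) ∧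
        ρ'.cfg r' = Config.juxt ((ρ.cfg 1).pow κ) ((ρ.cfg e).pow N) := by
  have hcomm := ρ.step_comm 0 hbal.1 hbal.2.1
  obtain ⟨d, hd, hseg⟩ := ρ.exists_segment hbal.2.1 hphase.1 (hphase.2.1.trans (n.sub_le 1))
  obtain ⟨hdc, hdle⟩ := hphase.reconf_le hbal hd
  exact ⟨d, hdle, hseg.exists_execution hcomm hdc⟩

end RBN
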